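/- arXiv:2404.18487 — 3 statements merged into one kernel-verified Lean document; each statement's English description precedes it below -/
import Mathlib

section
/- Let G = (V, E, A) be a symmetric connected graph on V = {1,...,N} with a_l = min_{(i,j)∈E} a_{ij}, r the maximal graph distance, and |E^c| the cardinality of the complement of E in V×V. Let K > 0, α ∈ (0, π/2), D₀ ∈ (0, π), and let θ_1,...,θ_N be real numbers with max_{1≤i,j≤N} |θ_i − θ_j| < D₀. Then (K/N) cos α · Σ_{i=1}^N Σ_{j=1}^N Σ_{l=1}^N [a_{il} sin(θ_l − θ_i) − a_{jl} sin(θ_l − θ_j)] · 2(θ_i − θ_j) ≤ −2 K a_l cos α · (sin D₀ / D₀) · (1/(1 + r|E^c|)) · Σ_{i=1}^N Σ_{j=1}^N |θ_i − θ_j|². -/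
open Finset Real

lemma aux_sin (D x : ℝ) (h0 : 0 < D) (h1 : D < Real.pi) (hx : |x| < D) :
    Real.sin D / D * x ^ 2 ≤ Real.sin x * x := by
  have key : ∀ y : ℝ, 0 ≤ y → y < D → Real.sin D / D * y ≤ Real.sin y := by
    intro y hy hyD
    have hc := strictConcaveOn_sin_Icc.concaveOn.2
      (show (0 : ℝ) ∈ Set.Icc 0 Real.pi from ⟨le_refl _, Real.pi_pos.le⟩)
      (show D ∈ Set.Icc 0 Real.pi from ⟨h0.le, h1.le⟩)
      (show 0 ≤ 1 - y / D by rw [sub_nonneg, div_le_one h0]; exact hyD.le)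
      (show 0 ≤ y / D by positivity) (by ring)
    simp only [smul_eq_mul, Real.sin_zero, mul_zero, zero_add] at hc
    rw [div_mul_cancel₀ _ h0.ne'] at hc
    calc _ = y / D * Real.sin D := by ring
      _ ≤ _ := hc
  have h2 := key |x| (abs_nonneg x) hx
  rcases le_total 0 x with h | h
  · rw [abs_of_nonneg h] at h2
    nlinarith [mul_le_mul_of_nonneg_right h2 h]
  · rw [abs_of_nonpos h, Real.sin_neg] at h2
    nlinarith [mul_le_mul_of_nonneg_right h2 (neg_nonneg.2 h)]

lemma aux_cs (x y n S : ℝ) (hn : 0 ≤ n) (hS : 0 ≤ S) (h : y ^ 2 ≤ n * S) :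
    (x + y) ^ 2 ≤ (n + 1) * (x ^ 2 + S) := by
  have h1 : 2 * x * y ≤ n * x ^ 2 + S := by
    refine abs_le_of_sq_le_sq' ?_  (by positivity) |>.2
    nlinarith [mul_le_mul_of_nonneg_left h (sq_nonneg x), sq_nonneg (n * x ^ 2 - S)]
  nlinarith

lemma aux_walk {V : Type*} (G : SimpleGraph V) (θ : V → ℝ) {u v : V} (p : G.Walk u v) :
    0 ≤ (p.darts.map (fun d => (θ d.fst - θ d.snd) ^ 2)).sum ∧
    (θ u - θ v) ^ 2 ≤ (p.length : ℝ) * (p.darts.map (fun d => (θ d.fst - θ d.snd) ^ 2)).sum := by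
  induction p with
  | nil => simp
  | @cons u w v h p ih =>
    obtain ⟨h1, h2⟩ := ih
    simp only [SimpleGraph.Walk.darts_cons, List.map_cons, List.sum_cons,
      SimpleGraph.Walk.length_cons]
    refine ⟨by positivity, ?_⟩
    have := aux_cs (θ u - θ w) (θ w - θ v) _ _ (Nat.cast_nonneg _) h1 h2
    push_cast
    simpa using this

lemma aux_dist {N : ℕ} (G : SimpleGraph (Fin N)) (hconn : G.Connected) (θ : Fin N → ℝ)
    (E : Finset (Fin N × Fin N)) (hE : ∀ i j, G.Adj i j → (i, j) ∈ E) (u v : Fin N) :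
    (θ u - θ v) ^ 2 ≤ (G.dist u v : ℝ) * ∑ p ∈ E, (θ p.1 - θ p.2) ^ 2 := by
  obtain ⟨p, hp, hl⟩ := hconn.exists_path_of_dist u v
  refine (aux_walk G θ p).2.trans ?_
  rw [hl]
  refine mul_le_mul_of_nonneg_left ?_ (Nat.cast_nonneg _)
  have hnd : p.darts.Nodup := List.Nodup.of_map _ hp.isTrail.edges_nodup
  have hnd2 : (p.darts.map (fun d => d.toProd)).Nodup :=
    hnd.map (fun a b h => SimpleGraph.Dart.ext _ _ h)
  have e : (p.darts.map (fun d => (θ d.fst - θ d.snd) ^ 2))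
      = (p.darts.map (fun d => d.toProd)).map (fun q => (θ q.1 - θ q.2) ^ 2) := by
    rw [List.map_map]; rfl
  rw [e, ← List.sum_toFinset _ hnd2]
  refine Finset.sum_le_sum_of_subset_of_nonneg ?_ (fun _ _ _ => sq_nonneg _)
  intro q hq
  simp only [List.mem_toFinset, List.mem_map] at hq
  obtain ⟨d, _, rfl⟩ := hq
  exact hE _ _ d.adj

lemma aux_sum {N : ℕ} (a : Fin N → Fin N → ℝ) (hsym : ∀ i j, a i j = a j i) (θ : Fin N → ℝ) :
    ∑ i, ∑ j, ∑ l, (a i l * Real.sin (θ l - θ i) - a j l * Real.sin (θ l - θ j))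
          * (2 * (θ i - θ j))
      = - 2 * N * ∑ i, ∑ l, a i l * (Real.sin (θ i - θ l) * (θ i - θ l)) := by
  set s : Fin N → ℝ := fun i => ∑ l, a i l * Real.sin (θ l - θ i) with hs
  have anti : ∀ i l, a i l * Real.sin (θ l - θ i) = -(a l i * Real.sin (θ i - θ l)) := by
    intro i l
    rw [hsym i l, ← neg_sub (θ i) (θ l), Real.sin_neg]; ring
  have h0 : ∑ i, s i = 0 := by
    have : ∑ i, s i = - ∑ i, s i := by
      conv_lhs => rw [hs, Finset.sum_comm]
      simp only [hs, ← Finset.sum_neg_distrib]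
      exact Finset.sum_congr rfl fun i _ => Finset.sum_congr rfl fun l _ => anti l i
    linarith
  have h1 : ∑ i, ∑ l, a i l * (Real.sin (θ i - θ l) * (θ i - θ l)) = -2 * ∑ i, s i * θ i := by
    have e1 : ∑ i, s i * θ i = ∑ i, ∑ l, a i l * Real.sin (θ l - θ i) * θ i := by
      simp only [hs, Finset.sum_mul]
    have e2 : ∑ i, s i * θ i = ∑ i, ∑ l, a l i * Real.sin (θ i - θ l) * θ l := by
      rw [e1, Finset.sum_comm]
    have e3 : -2 * ∑ i, s i * θ i = -(∑ i, ∑ l, a i l * Real.sin (θ l - θ i) * θ i)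
       - ∑ i, ∑ l, a l i * Real.sin (θ i - θ l) * θ l := by
      rw [← e1, ← e2]; ring
    rw [e3, ← Finset.sum_neg_distrib, ← Finset.sum_sub_distrib]
    refine Finset.sum_congr rfl fun i _ => ?_
    rw [← Finset.sum_neg_distrib, ← Finset.sum_sub_distrib]
    refine Finset.sum_congr rfl fun l _ => ?_
    rw [anti i l, hsym i l]; ring
  have h2 : ∀ i j, ∑ l, (a i l * Real.sin (θ l - θ i) - a j l * Real.sin (θ l - θ j))
          * (2 * (θ i - θ j)) = 2 * (s i * θ i) - 2 * (θ j * s i) - 2 * (s j * θ i)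
            + 2 * (s j * θ j) := by
    intro i j
    rw [← Finset.sum_mul, Finset.sum_sub_distrib]
    simp only [hs]; ring
  simp only [h2, h1, Finset.sum_add_distrib, Finset.sum_sub_distrib, ← Finset.mul_sum,
    ← Finset.sum_mul, h0, Finset.sum_const, Finset.card_univ, Fintype.card_fin, nsmul_eq_mul]
  have h3 : ∑ x, s x * (N : ℝ) * θ x = N * ∑ x, s x * θ x := by
    rw [Finset.mul_sum]
    exact Finset.sum_congr rfl fun x _ => by ring
  ring_nf
  rw [h3]
  ring

/-- dissipation estimate of the sine coupling term against the phase differences. -/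
theorem sine_coupling_phase_dissipation
    (N : ℕ) (hN : 0 < N)
    (a : Fin N → Fin N → ℝ)
    (hsym : ∀ i j, a i j = a j i)
    (hnn : ∀ i j, 0 ≤ a i j)
    (G : SimpleGraph (Fin N))
    (hadj : ∀ i j, G.Adj i j ↔ i ≠ j ∧ 0 < a i j)
    (hconn : G.Connected)
    (hEne : (Finset.filter (fun p : Fin N × Fin N => 0 < a p.1 p.2) Finset.univ).Nonempty)
    (r : ℕ)
    (hr : r = Finset.univ.sup (fun p : Fin N × Fin N => G.dist p.1 p.2))
    (Ec : ℕ)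
    (hEc : Ec = (Finset.filter
      (fun p : Fin N × Fin N => ¬ 0 < a p.1 p.2) Finset.univ).card)
    (al : ℝ)
    (hal : al = (Finset.filter (fun p : Fin N × Fin N => 0 < a p.1 p.2) Finset.univ).inf' hEne (fun p => a p.1 p.2))
    (K α D0 : ℝ) (hK : 0 < K) (hα : 0 < α ∧ α < Real.pi / 2)
    (hD0 : 0 < D0 ∧ D0 < Real.pi)
    (θ : Fin N → ℝ)
    (hdiam : ∀ i j, |θ i - θ j| < D0) :
    (K / (N : ℝ)) * Real.cos α *
        ∑ i, ∑ j, ∑ l, (a i l * Real.sin (θ l - θ i) - a j l * Real.sin (θ l - θ j))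
          * (2 * (θ i - θ j))
      ≤ -2 * K * al * Real.cos α * (Real.sin D0 / D0)
          * (1 / (1 + (r : ℝ) * (Ec : ℝ))) * ∑ i, ∑ j, |θ i - θ j| ^ 2 := by
  rw [aux_sum a hsym θ]
  have hN' : (0 : ℝ) < N := Nat.cast_pos.2 hN
  have hcos : 0 < Real.cos α := Real.cos_pos_of_mem_Ioo ⟨by linarith [hα.1, Real.pi_pos], hα.2⟩
  have hsin : 0 < Real.sin D0 := Real.sin_pos_of_pos_of_lt_pi hD0.1 hD0.2
  have hD := hD0.1
  set c := Real.sin D0 / D0 with hc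
  have hc0 : 0 < c := by positivity
  set E := Finset.filter (fun p : Fin N × Fin N => 0 < a p.1 p.2) Finset.univ with hEdef
  have hal0 : 0 < al := by
    rw [hal, Finset.lt_inf'_iff]
    intro p hp
    exact (Finset.mem_filter.1 hp).2
  have hal1 : ∀ p ∈ E, al ≤ a p.1 p.2 := by
    intro p hp
    rw [hal]
    exact Finset.inf'_le (fun p : Fin N × Fin N => a p.1 p.2) hp
  set SE := ∑ p ∈ E, (θ p.1 - θ p.2) ^ 2 with hSE
  have hSE0 : 0 ≤ SE := Finset.sum_nonneg fun _ _ => sq_nonneg _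
  have hpair : ∀ i j, (θ i - θ j) ^ 2 ≤ (r : ℝ) * SE := by
    intro i j
    refine (aux_dist G hconn θ E ?_ i j).trans ?_
    · intro i j h
      simpa [hEdef] using ((hadj i j).1 h).2
    · refine mul_le_mul_of_nonneg_right ?_ hSE0
      rw [hr]
      exact_mod_cast Finset.le_sup (f := fun p : Fin N × Fin N => G.dist p.1 p.2)
        (Finset.mem_univ (i, j))
  have hall : ∑ i, ∑ j, |θ i - θ j| ^ 2 ≤ (1 + (r : ℝ) * Ec) * SE := by
    simp only [sq_abs]
    rw [← Fintype.sum_prod_type' (fun i j => (θ i - θ j) ^ 2),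
      ← Finset.sum_filter_add_sum_filter_not Finset.univ
        (fun p : Fin N × Fin N => 0 < a p.1 p.2)]
    have := Finset.sum_le_card_nsmul (Finset.filter
      (fun p : Fin N × Fin N => ¬ 0 < a p.1 p.2) Finset.univ)
      (fun p => (θ p.1 - θ p.2) ^ 2) ((r : ℝ) * SE) (fun p _ => hpair p.1 p.2)
    rw [← hEc, nsmul_eq_mul] at this
    linarith
  have hlow : al * c * SE ≤ ∑ i, ∑ l, a i l * (Real.sin (θ i - θ l) * (θ i - θ l)) := by
    rw [← Fintype.sum_prod_type' (fun i l => a i l * (Real.sin (θ i - θ l) * (θ i - θ l)))]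
    have hs : ∀ p : Fin N × Fin N, c * (θ p.1 - θ p.2) ^ 2 ≤
        Real.sin (θ p.1 - θ p.2) * (θ p.1 - θ p.2) :=
      fun p => aux_sin D0 _ hD0.1 hD0.2 (hdiam p.1 p.2)
    have hs0 : ∀ p : Fin N × Fin N, 0 ≤ Real.sin (θ p.1 - θ p.2) * (θ p.1 - θ p.2) :=
      fun p => le_trans (by positivity) (hs p)
    calc al * c * SE = ∑ p ∈ E, al * (c * (θ p.1 - θ p.2) ^ 2) := by
          rw [hSE, Finset.mul_sum]; exact Finset.sum_congr rfl fun _ _ => by ring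
      _ ≤ ∑ p ∈ E, a p.1 p.2 * (Real.sin (θ p.1 - θ p.2) * (θ p.1 - θ p.2)) :=
          Finset.sum_le_sum fun p hp =>
            mul_le_mul (hal1 p hp) (hs p) (by positivity) (hnn _ _)
      _ ≤ _ := Finset.sum_le_sum_of_subset_of_nonneg (Finset.subset_univ _)
            fun p _ _ => mul_nonneg (hnn _ _) (hs0 p)
  set T := ∑ i, ∑ l, a i l * (Real.sin (θ i - θ l) * (θ i - θ l)) with hT
  set Q := ∑ i, ∑ j, |θ i - θ j| ^ 2 with hQ
  have hden : (0 : ℝ) < 1 + (r : ℝ) * Ec := by positivity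
  have hQ1 : 1 / (1 + (r : ℝ) * Ec) * Q ≤ SE := by
    rw [one_div, inv_mul_le_iff₀ hden]; exact hall
  have hfin : al * c * (1 / (1 + (r : ℝ) * Ec) * Q) ≤ T :=
    (mul_le_mul_of_nonneg_left hQ1 (by positivity)).trans hlow
  have hmul := mul_le_mul_of_nonneg_left hfin (show 0 ≤ 2 * K * Real.cos α by positivity)
  have e : K / (N : ℝ) * Real.cos α * (-2 * N * T) = -(2 * K * Real.cos α * T) := by
    field_simp
  rw [e]
  linarith
end

section
/- Let G = (V, E, A) be a symmetric connected graph on V = {1,...,N} with a_l = min_{(i,j)∈E} a_{ij}, r the maximal graph distance, and |E^c| the cardinality of the complement of E in V×V. Let K > 0, α ∈ (0, π/2), D^∞ ∈ (0, π/2), and let θ_1,...,θ_N and ω_1,...,ω_N be real numbers with max_{1≤i,j≤N}|θ_i − θ_j| ≤ D^∞. Then (K/N) cos α · Σ_{i=1}^N Σ_{j=1}^N Σ_{l=1}^N [a_{il} cos(θ_l − θ_i)(ω_l − ω_i) − a_{jl} cos(θ_l − θ_j)(ω_l − ω_j)] · 2(ω_i − ω_j) ≤ −2 K a_l cos α cos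 D^∞ · (1/(1 + r|E^c|)) · Σ_{i=1}^N Σ_{j=1}^N (ω_i − ω_j)². -/
open Finset Real


lemma walk_sq_le {V : Type*} (G : SimpleGraph V) (ω : V → ℝ) {u v : V} (p : G.Walk u v) :
    0 ≤ ((p.darts.map (fun d => d.toProd)).map (fun q => (ω q.1 - ω q.2) ^ 2)).sum ∧
    (ω u - ω v) ^ 2 ≤ (p.length : ℝ) *
      ((p.darts.map (fun d => d.toProd)).map (fun q => (ω q.1 - ω q.2) ^ 2)).sum := by
  induction p with
  | nil => simp
  | @cons u v w h p ih =>
    obtain ⟨h0, h1⟩ := ih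
    simp only [SimpleGraph.Walk.darts_cons, List.map_cons, List.sum_cons,
      SimpleGraph.Walk.length_cons, Nat.cast_add, Nat.cast_one]
    generalize ((p.darts.map (fun d => d.toProd)).map (fun q => (ω q.1 - ω q.2) ^ 2)).sum = S at *
    have hn : (0 : ℝ) ≤ (p.length : ℝ) := Nat.cast_nonneg _
    generalize (p.length : ℝ) = n at *
    refine ⟨by positivity, ?_⟩
    obtain ⟨x, hx⟩ : ∃ x, x = ω u - ω v := ⟨_, rfl⟩
    obtain ⟨y, hy⟩ : ∃ y, y = ω v - ω w := ⟨_, rfl⟩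
    have e : ω u - ω w = x + y := by rw [hx, hy]; ring
    rw [e, ← hx]
    rw [← hy] at h1
    have k : 2 * x * y ≤ n * x ^ 2 + S := by
      refine (abs_le_of_sq_le_sq' ?_ (by positivity)).2
      have := mul_le_mul_of_nonneg_left h1 (sq_nonneg x)
      nlinarith [sq_nonneg (n * x ^ 2 - S)]
    nlinarith

lemma sum_identity {N : ℕ} (c : Fin N → Fin N → ℝ) (hc : ∀ i j, c i j = c j i) (ω : Fin N → ℝ) :
    ∑ i, ∑ j, ∑ l, (c i l * (ω l - ω i) - c j l * (ω l - ω j)) * (2 * (ω i - ω j))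
      = -2 * N * ∑ i, ∑ l, c i l * (ω l - ω i) ^ 2 := by
  obtain ⟨F, hF⟩ : ∃ F : Fin N → ℝ, ∀ i, F i = ∑ l, c i l * (ω l - ω i) := ⟨_, fun _ => rfl⟩
  have hF0 : ∑ i, F i = 0 := by
    have h : ∑ i, F i = - ∑ i, F i := by
      simp only [hF]
      conv_lhs => rw [Finset.sum_comm]
      rw [← Finset.sum_neg_distrib]
      refine Finset.sum_congr rfl fun i _ => ?_
      rw [← Finset.sum_neg_distrib]
      refine Finset.sum_congr rfl fun l _ => ?_
      rw [hc l i]; ring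
    linarith
  have hF1 : ∑ i, ∑ l, c i l * (ω l - ω i) ^ 2 = -2 * ∑ i, F i * ω i := by
    have h1 : ∑ i, ∑ l, c i l * (ω l - ω i) * ω l = - ∑ i, F i * ω i := by
      simp only [hF, Finset.sum_mul]
      rw [Finset.sum_comm, ← Finset.sum_neg_distrib]
      refine Finset.sum_congr rfl fun i _ => ?_
      rw [← Finset.sum_neg_distrib]
      refine Finset.sum_congr rfl fun l _ => ?_
      rw [hc l i]; ring
    have h2 : ∑ i, ∑ l, c i l * (ω l - ω i) ^ 2
        = ∑ i, ∑ l, c i l * (ω l - ω i) * ω l - ∑ i, F i * ω i := by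
      simp only [hF, Finset.sum_mul]
      simp only [← Finset.sum_sub_distrib]
      refine Finset.sum_congr rfl fun i _ => Finset.sum_congr rfl fun l _ => ?_
      ring
    rw [h2, h1]; ring
  have h3 : ∀ i j, ∑ l, (c i l * (ω l - ω i) - c j l * (ω l - ω j)) * (2 * (ω i - ω j))
      = 2 * (F i * ω i) - 2 * (F i * ω j) - 2 * (ω i * F j) + 2 * (F j * ω j) := by
    intro i j
    rw [← Finset.sum_mul, Finset.sum_sub_distrib, ← hF, ← hF]; ring
  simp only [h3, hF1, Finset.sum_add_distrib, Finset.sum_sub_distrib, ← Finset.mul_sum,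
    ← Finset.sum_mul, hF0]
  simp
  have h4 : ∑ x, F x * (N : ℝ) * ω x = N * ∑ x, F x * ω x := by
    rw [Finset.mul_sum]
    exact Finset.sum_congr rfl fun x _ => by ring
  ring_nf
  rw [h4]
  ring

/-- dissipation of the cosine coupling term in the frequency equation. -/
theorem cosine_coupling_frequency_dissipation
    (N : ℕ) (hN : 0 < N)
    (a : Fin N → Fin N → ℝ)
    (hsym : ∀ i j, a i j = a j i)
    (hnn : ∀ i j, 0 ≤ a i j)
    (G : SimpleGraph (Fin N))
    (hadj : ∀ i j, G.Adj i j ↔ i ≠ j ∧ 0 < a i j)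
    (hconn : G.Connected)
    (hEne : (Finset.filter (fun p : Fin N × Fin N => 0 < a p.1 p.2) Finset.univ).Nonempty)
    (r : ℕ)
    (hr : r = Finset.univ.sup (fun p : Fin N × Fin N => G.dist p.1 p.2))
    (Ec : ℕ)
    (hEc : Ec = (Finset.filter
      (fun p : Fin N × Fin N => ¬ 0 < a p.1 p.2) Finset.univ).card)
    (al : ℝ)
    (hal : al = (Finset.filter (fun p : Fin N × Fin N => 0 < a p.1 p.2) Finset.univ).inf' hEne (fun p => a p.1 p.2))
    (K α Dinf : ℝ) (hK : 0 < K) (hα : 0 < α ∧ α < Real.pi / 2)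
    (hDinf : 0 < Dinf ∧ Dinf < Real.pi / 2)
    (θ ω : Fin N → ℝ)
    (hdiam : ∀ i j, |θ i - θ j| ≤ Dinf) :
    (K / (N : ℝ)) * Real.cos α *
        ∑ i, ∑ j, ∑ l,
          (a i l * Real.cos (θ l - θ i) * (ω l - ω i)
            - a j l * Real.cos (θ l - θ j) * (ω l - ω j)) * (2 * (ω i - ω j))
      ≤ -2 * K * al * Real.cos α * Real.cos Dinf
          * (1 / (1 + (r : ℝ) * (Ec : ℝ))) * ∑ i, ∑ j, (ω i - ω j) ^ 2 := by
  have hcα : 0 < Real.cos α := Real.cos_pos_of_mem_Ioo ⟨by linarith [Real.pi_pos], hα.2⟩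
  have hcD : 0 < Real.cos Dinf :=
    Real.cos_pos_of_mem_Ioo ⟨by linarith [Real.pi_pos], hDinf.2⟩
  have hNR : (0 : ℝ) < N := by exact_mod_cast hN
  have hal0 : 0 < al := by
    rw [hal, Finset.lt_inf'_iff]
    intro p hp
    exact (Finset.mem_filter.mp hp).2
  have hale : ∀ i j, 0 < a i j → al ≤ a i j := by
    intro i j h
    rw [hal]
    exact Finset.inf'_le (fun p : Fin N × Fin N => a p.1 p.2) (b := (i, j)) (by simp [h])
  have hcos : ∀ i j, Real.cos Dinf ≤ Real.cos (θ j - θ i) := by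
    intro i j
    rw [← Real.cos_abs (θ j - θ i)]
    exact Real.cos_le_cos_of_nonneg_of_le_pi (abs_nonneg _) (by linarith [Real.pi_pos])
      (hdiam j i)
  rw [sum_identity (fun i l => a i l * Real.cos (θ l - θ i))
    (fun i j => by rw [hsym i j, ← Real.cos_neg (θ j - θ i), neg_sub]) ω]
  obtain ⟨E, hE⟩ : ∃ E : Finset (Fin N × Fin N),
    E = Finset.filter (fun p : Fin N × Fin N => 0 < a p.1 p.2) Finset.univ := ⟨_, rfl⟩
  obtain ⟨S, hS⟩ : ∃ S : ℝ, S = ∑ p ∈ E, (ω p.1 - ω p.2) ^ 2 := ⟨_, rfl⟩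
  have hS0 : 0 ≤ S := by rw [hS]; exact Finset.sum_nonneg fun _ _ => sq_nonneg _
  have hpair : ∀ i j, (ω i - ω j) ^ 2 ≤ r * S := by
    intro i j
    obtain ⟨p, hp, hl⟩ := hconn.exists_path_of_dist i j
    obtain ⟨h0, h1⟩ := walk_sq_le G ω p
    have hnd : (p.darts.map (fun d => d.toProd)).Nodup := by
      refine List.Nodup.map SimpleGraph.Dart.toProd_injective ?_
      exact List.Nodup.of_map _ hp.isTrail.edges_nodup
    have hlr : (p.length : ℝ) ≤ r := by
      rw [hl, hr]
      exact_mod_cast Finset.le_sup (f := fun p : Fin N × Fin N => G.dist p.1 p.2)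
        (Finset.mem_univ (i, j))
    have hsum : ((p.darts.map (fun d => d.toProd)).map (fun q => (ω q.1 - ω q.2) ^ 2)).sum
        ≤ S := by
      rw [← List.sum_toFinset _ hnd, hS]
      refine Finset.sum_le_sum_of_subset_of_nonneg ?_ fun _ _ _ => sq_nonneg _
      intro q hq
      rw [List.mem_toFinset, List.mem_map] at hq
      obtain ⟨d, _, rfl⟩ := hq
      rw [hE]
      simpa using ((hadj _ _).mp d.adj).2
    exact h1.trans (mul_le_mul hlr hsum h0 (Nat.cast_nonneg _))
  have hall : ∑ i, ∑ j, (ω i - ω j) ^ 2 ≤ (1 + (r : ℝ) * Ec) * S := by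
    rw [← Fintype.sum_prod_type' (fun i j => (ω i - ω j) ^ 2),
      ← Finset.sum_filter_add_sum_filter_not Finset.univ
        (fun p : Fin N × Fin N => 0 < a p.1 p.2), ← hE, ← hS]
    have := Finset.sum_le_card_nsmul (Finset.filter
      (fun p : Fin N × Fin N => ¬ 0 < a p.1 p.2) Finset.univ)
      (fun p => (ω p.1 - ω p.2) ^ 2) (r * S) (fun p _ => hpair p.1 p.2)
    rw [← hEc, nsmul_eq_mul] at this
    linarith
  have hlow : al * Real.cos Dinf * S
      ≤ ∑ i, ∑ l, a i l * Real.cos (θ l - θ i) * (ω l - ω i) ^ 2 := by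
    rw [← Fintype.sum_prod_type' (fun i l => a i l * Real.cos (θ l - θ i) * (ω l - ω i) ^ 2),
      hS, Finset.mul_sum]
    refine (Finset.sum_le_sum fun p hp => ?_).trans
      (Finset.sum_le_sum_of_subset_of_nonneg (Finset.subset_univ E) fun p _ _ => ?_)
    · have hp' : 0 < a p.1 p.2 := by rw [hE] at hp; exact (Finset.mem_filter.mp hp).2
      rw [show (ω p.1 - ω p.2) ^ 2 = (ω p.2 - ω p.1) ^ 2 by ring]
      exact mul_le_mul_of_nonneg_right
        (mul_le_mul (hale _ _ hp') (hcos _ _) hcD.le hp'.le) (sq_nonneg _)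
    · exact mul_nonneg (mul_nonneg (hnn _ _) (hcD.le.trans (hcos _ _))) (sq_nonneg _)
  have hden : (0 : ℝ) < 1 + (r : ℝ) * Ec := by positivity
  have hdiv : 1 / (1 + (r : ℝ) * Ec) * ∑ i, ∑ j, (ω i - ω j) ^ 2 ≤ S := by
    rw [one_div, inv_mul_le_iff₀ hden]; exact hall
  have hfin := (mul_le_mul_of_nonneg_left hdiv (mul_pos hal0 hcD).le).trans hlow
  have hfin2 := mul_le_mul_of_nonneg_left hfin (mul_pos hK hcα).le
  generalize (∑ i, ∑ j, (ω i - ω j) ^ 2) = T at *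
  generalize (∑ i, ∑ l, a i l * Real.cos (θ l - θ i) * (ω l - ω i) ^ 2) = Q at *
  have e : K / (N : ℝ) * Real.cos α * (-2 * N * Q) = -2 * (K * Real.cos α * Q) := by
    field_simp
  rw [e]
  linarith
end

section
/- Let G = (V, E, A) be a symmetric connected graph on V = {1,...,N} with a_u = max_{(i,j)∈E} a_{ij}. Let m > 0, K > 0, α ∈ (0, π/2), D^∞ ∈ (0, π/2), and let θ_1,...,θ_N, ω_1,...,ω_N, ν_1,...,ν_N be real numbers with max_{1≤i,j≤N}|θ_i − θ_j| ≤ D^∞. Then (2mK/N) cos α · Σ_{i=1}^N Σ_{j=1}^N Σ_{l=1}^N [a_{il} cos(θ_l − θ_i)(ω_l − ω_i) − a_{jl} cos(θ_l − θ_j)(ω_l − ω_j)] · 2(ν_i − ν_j) ≤ 8 m K² a_u² cos²α · Σ_{i=1}^N Σ_{j=1}^N (ω_i − ω_j)² + (m/2) Σ_{i=1}^N Σ_{j=1}^N (ν_i − ν_j)². -/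
open Finset Real

theorem antisymm_sum_identity (N : ℕ) (g : Fin N → Fin N → ℝ) (ν : Fin N → ℝ)
    (hg : ∀ i j, g i j = - g j i) :
    ∑ i, ∑ j, ∑ l, (g i l - g j l) * (2 * (ν i - ν j))
      = 2 * (N : ℝ) * ∑ i, ∑ l, g i l * (ν i - ν l) := by
  have h0 : ∑ i, ∑ l, g i l = 0 := by
    have h : ∑ i, ∑ l, g i l = - ∑ i, ∑ l, g i l := by
      conv_lhs => rw [Finset.sum_comm]
      rw [← Finset.sum_neg_distrib]
      refine Finset.sum_congr rfl fun i _ => ?_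
      rw [← Finset.sum_neg_distrib]
      exact Finset.sum_congr rfl fun j _ => hg j i
    linarith
  have h1 : ∑ i, ∑ l, g i l * ν l = - ∑ i, ∑ l, g i l * ν i := by
    rw [Finset.sum_comm, ← Finset.sum_neg_distrib]
    refine Finset.sum_congr rfl fun i _ => ?_
    rw [← Finset.sum_neg_distrib]
    refine Finset.sum_congr rfl fun j _ => ?_
    rw [hg j i]; ring
  have hR : ∑ i, ∑ l, g i l * (ν i - ν l) = 2 * ∑ i, ∑ l, g i l * ν i := by
    simp only [mul_sub, Finset.sum_sub_distrib]
    rw [h1]; ring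
  rw [hR]
  have hF : ∀ i j, ∑ l, (g i l - g j l) * (2 * (ν i - ν j))
      = 2 * ((∑ l, g i l * ν i) - (∑ l, g i l) * ν j - (∑ l, g j l) * ν i
        + ∑ l, g j l * ν j) := by
    intro i j
    rw [← Finset.sum_mul, ← Finset.sum_mul, ← Finset.sum_mul, Finset.sum_sub_distrib]
    ring
  simp only [hF, ← Finset.mul_sum, Finset.sum_add_distrib, Finset.sum_sub_distrib,
    ← Finset.sum_mul, h0, Finset.sum_const, Finset.card_univ, Fintype.card_fin, nsmul_eq_mul]
  have h5 : ∑ x, (N : ℝ) * ((∑ l, g x l) * ν x) = ∑ x, (∑ l, g x l) * (N : ℝ) * ν x :=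
    Finset.sum_congr rfl fun x _ => by ring
  rw [← Finset.mul_sum] at h5
  ring_nf at h5 ⊢
  linarith

/-- estimate of the cosine coupling term against the acceleration differences. -/
theorem cosine_coupling_acceleration_estimate
    (N : ℕ) (hN : 0 < N)
    (a : Fin N → Fin N → ℝ)
    (hsym : ∀ i j, a i j = a j i)
    (hnn : ∀ i j, 0 ≤ a i j)
    (G : SimpleGraph (Fin N))
    (hadj : ∀ i j, G.Adj i j ↔ i ≠ j ∧ 0 < a i j)
    (hconn : G.Connected)
    (hEne : (Finset.filter (fun p : Fin N × Fin N => 0 < a p.1 p.2) Finset.univ).Nonempty)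
    (r : ℕ)
    (hr : r = Finset.univ.sup (fun p : Fin N × Fin N => G.dist p.1 p.2))
    (Ec : ℕ)
    (hEc : Ec = (Finset.filter
      (fun p : Fin N × Fin N => ¬ 0 < a p.1 p.2) Finset.univ).card)
    (au : ℝ)
    (hau : au = (Finset.filter (fun p : Fin N × Fin N => 0 < a p.1 p.2) Finset.univ).sup' hEne (fun p => a p.1 p.2))
    (m K α Dinf : ℝ) (hm : 0 < m) (hK : 0 < K) (hα : 0 < α ∧ α < Real.pi / 2)
    (hDinf : 0 < Dinf ∧ Dinf < Real.pi / 2)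
    (θ ω ν : Fin N → ℝ)
    (hdiam : ∀ i j, |θ i - θ j| ≤ Dinf) :
    (2 * m * K / (N : ℝ)) * Real.cos α *
        ∑ i, ∑ j, ∑ l,
          (a i l * Real.cos (θ l - θ i) * (ω l - ω i)
            - a j l * Real.cos (θ l - θ j) * (ω l - ω j)) * (2 * (ν i - ν j))
      ≤ 8 * m * K ^ 2 * au ^ 2 * Real.cos α ^ 2 * ∑ i, ∑ j, (ω i - ω j) ^ 2
        + (m / 2) * ∑ i, ∑ j, (ν i - ν j) ^ 2 := by
  have hN' : (0 : ℝ) < N := by exact_mod_cast hN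
  have hb : ∀ i l, 0 ≤ a i l * Real.cos (θ l - θ i) ∧ a i l * Real.cos (θ l - θ i) ≤ au := by
    intro i l
    have hau' : a i l ≤ au := by
      by_cases h : 0 < a i l
      · rw [hau]
        exact Finset.le_sup' (fun p : Fin N × Fin N => a p.1 p.2)
          (b := (i, l)) (by simp [h])
      · obtain ⟨p, hp⟩ := hEne
        have h2 : a p.1 p.2 ≤ au := by
          rw [hau]
          exact Finset.le_sup' (fun p : Fin N × Fin N => a p.1 p.2) hp
        have h3 := hnn p.1 p.2
        linarith
    have h1 := abs_le.mp (hdiam l i)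
    have hc : 0 ≤ Real.cos (θ l - θ i) :=
      Real.cos_nonneg_of_mem_Icc ⟨by linarith [h1.1, hDinf.2], by linarith [h1.2, hDinf.2]⟩
    refine ⟨mul_nonneg (hnn i l) hc, ?_⟩
    have := mul_le_mul_of_nonneg_left (Real.cos_le_one (θ l - θ i)) (hnn i l)
    linarith
  have hid := antisymm_sum_identity N
    (fun i l => a i l * Real.cos (θ l - θ i) * (ω l - ω i)) ν (by
      intro i j
      rw [hsym i j, ← Real.cos_neg (θ j - θ i), neg_sub]
      ring)
  rw [hid]
  have he : (2 * m * K / (N : ℝ)) * Real.cos α * (2 * (N : ℝ) *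
      ∑ i, ∑ l, a i l * Real.cos (θ l - θ i) * (ω l - ω i) * (ν i - ν l))
      = (4 * m * (K * Real.cos α)) *
      ∑ i, ∑ l, a i l * Real.cos (θ l - θ i) * (ω l - ω i) * (ν i - ν l) := by
    field_simp
    ring
  rw [he]
  simp only [Finset.mul_sum]
  rw [← Finset.sum_add_distrib]
  refine Finset.sum_le_sum fun i _ => ?_
  rw [← Finset.sum_add_distrib]
  refine Finset.sum_le_sum fun l _ => ?_
  obtain ⟨hb0, hb1⟩ := hb i l
  generalize a i l * Real.cos (θ l - θ i) = b at hb0 hb1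
  have hsq : b ^ 2 ≤ au ^ 2 := pow_le_pow_left₀ hb0 hb1 2
  have h1 : 0 ≤ m / 2 * (4 * (K * Real.cos α) * b * (ω i - ω l) + (ν i - ν l)) ^ 2 := by
    positivity
  have h2 : 8 * m * (K * Real.cos α) ^ 2 * (ω i - ω l) ^ 2 * b ^ 2
      ≤ 8 * m * (K * Real.cos α) ^ 2 * (ω i - ω l) ^ 2 * au ^ 2 :=
    mul_le_mul_of_nonneg_left hsq (by positivity)
  have h3 : 0 ≤ m / 2 * (4 * (K * Real.cos α) * b * (ω i - ω l) + (ν i - ν l)) ^ 2 := h1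
  linarith
end
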